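/- Let M be an n-maniplex with an ℓ-colouring C of its facets and weight function ω: E(M) → ℤ_k. If M^ω satisfies the string property, then the cross-cover (2^{(M,C)})^{ω_C} of the colour-coded extension with the extended weight function ω_C also satisfies the string property. -/

import Mathlib

/-- A maniplex of rank `n` in permutation form: a flag set `F` together with
fixed-point-free involutions `r i` (the `i`-adjacency maps, giving a proper
`n`-edge-colouring of an `n`-valent graph), satisfying the string property
(for non-consecutive colours `i, j` the maps commute and the `{i,j}`-subgraph
has no multiple edges, so that it is a disjoint union of 4-cycles), and
connectivity. -/
structure Maniplex (n : ℕ) (F : Type*) where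
  r : Fin n → F → F
  invol : ∀ i u, r i (r i u) = u
  free : ∀ i u, r i u ≠ u
  stringComm : ∀ i j : Fin n, (i : ℕ) + 1 < (j : ℕ) → ∀ u, r i (r j u) = r j (r i u)
  stringNe : ∀ i j : Fin n, (i : ℕ) + 1 < (j : ℕ) → ∀ u, r i u ≠ r j u
  conn : ∀ u v : F, ∃ l : List (Fin n), l.foldl (fun w i => r i w) u = v

/-- The flag reached from `u` by following the walk whose successive edge
colours are listed in `l`. -/
def walkEnd {n : ℕ} {F : Type*} (M : Maniplex n F) (l : List (Fin n)) (u : F) : F :=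
  l.foldl (fun w i => M.r i w) u

/-- The alternating weight `Σ (-1)^t ω(e_t)` of the walk starting at `u` whose
successive edge colours are listed in `l`. -/
def walkWeight {n k : ℕ} {F : Type*} (M : Maniplex n F) (ω : Fin n → F → ZMod k) :
    List (Fin n) → F → ZMod k
  | [], _ => 0
  | i :: t, u => ω i u - walkWeight M ω t (M.r i u)

/-- The `i`-adjacency map of the cross-cover `M^ω`: flags `F × ℤ_k`, with
`(u, a)` being `i`-adjacent to `(r i u, ω_i(u) - a)`. -/
def coverMap {n k : ℕ} {F : Type*} (M : Maniplex n F) (ω : Fin n → F → ZMod k)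
    (i : Fin n) : F × ZMod k → F × ZMod k :=
  fun p => (M.r i p.1, ω i p.1 - p.2)

/-- The parity sign `σ(x) = (-1)^{number of entries of x equal to 1}` of an
element `x ∈ ℤ_2^ℓ`. -/
def sgn {ℓ : ℕ} (x : Fin ℓ → ZMod 2) : ℤ :=
  (-1) ^ (∑ j, (x j).val)

/-- The `i`-adjacency maps of the colour-coded extension `2^(M,C)` of an
`n`-maniplex `M` with facet colouring `C` (given as a function `Cc` on flags):
flags are pairs `(u, x) ∈ F × ℤ_2^ℓ`, with `(u,x)^i = (u^i, x)` for `i < n` and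
`(u,x)^n = (u, x^{C(u)})`, where `x^j` flips the `j`-th coordinate of `x`. -/
def extMap {n ℓ : ℕ} {F : Type*} (M : Maniplex n F) (Cc : F → Fin ℓ) :
    Fin (n + 1) → F × (Fin ℓ → ZMod 2) → F × (Fin ℓ → ZMod 2) :=
  fun i p =>
    if h : (i : ℕ) < n then (M.r ⟨i, h⟩ p.1, p.2)
    else (p.1, Function.update p.2 (Cc p.1) (p.2 (Cc p.1) + 1))

/-- The extended weight function `ω_C` on the extension `2^(M,C)`: an `i`-edge
with `i < n` at a flag `(u, x)` gets weight `σ(x)·ω_i(u)`, and every `n`-edge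
gets weight `0`. -/
def extWeight {n ℓ k : ℕ} {F : Type*} (M : Maniplex n F) (Cc : F → Fin ℓ)
    (ω : Fin n → F → ZMod k) : Fin (n + 1) → F × (Fin ℓ → ZMod 2) → ZMod k :=
  fun i p => if h : (i : ℕ) < n then sgn p.2 • ω ⟨i, h⟩ p.1 else 0

/-- The `i`-adjacency maps of the cross-cover `(2^(M,C))^{ω_C}`. -/
def extCoverMap {n ℓ k : ℕ} {F : Type*} (M : Maniplex n F) (Cc : F → Fin ℓ)
    (ω : Fin n → F → ZMod k) (i : Fin (n + 1)) :
    (F × (Fin ℓ → ZMod 2)) × ZMod k → (F × (Fin ℓ → ZMod 2)) × ZMod k :=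
  fun q => (extMap M Cc i q.1, extWeight M Cc ω i q.1 - q.2)

theorem sgn_flip {ℓ : ℕ} (x : Fin ℓ → ZMod 2) (c : Fin ℓ) :
    sgn (Function.update x c (x c + 1)) = - sgn x := by
  unfold sgn
  rw [← Finset.prod_pow_eq_pow_sum, ← Finset.prod_pow_eq_pow_sum,
    ← Finset.mul_prod_erase _ _ (Finset.mem_univ c),
    ← Finset.mul_prod_erase Finset.univ (fun j => (-1 : ℤ) ^ (x j).val) (Finset.mem_univ c)]
  have h1 : ∀ y : ZMod 2, (-1 : ℤ) ^ (y + 1).val = - (-1 : ℤ) ^ y.val := by decide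
  have h2 : ∏ j ∈ Finset.univ.erase c,
      (-1 : ℤ) ^ (Function.update x c (x c + 1) j).val =
      ∏ j ∈ Finset.univ.erase c, (-1 : ℤ) ^ (x j).val := by
    refine Finset.prod_congr rfl fun j hj => ?_
    rw [Function.update_of_ne (Finset.ne_of_mem_erase hj)]
  rw [h2, Function.update_self, h1, neg_mul]

/-- If the cross-cover `M^ω` satisfies the string property, then so does the
cross-cover `(2^(M,C))^{ω_C}` of the colour-coded extension with the extended
weight function. -/
theorem extension_string {n ℓ k : ℕ} {F : Type*} (M : Maniplex n F)
    (Cc : F → Fin ℓ) (ω : Fin n → F → ZMod k)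
    (hC : ∀ i : Fin n, (i : ℕ) + 1 < n → ∀ u, Cc (M.r i u) = Cc u)
    (hω : ∀ i u, ω i (M.r i u) = ω i u)
    (hstring : ∀ i j : Fin n, (i : ℕ) + 1 < (j : ℕ) → ∀ p : F × ZMod k,
        coverMap M ω i (coverMap M ω j p) = coverMap M ω j (coverMap M ω i p) ∧
        coverMap M ω i p ≠ coverMap M ω j p) :
    ∀ i j : Fin (n + 1), (i : ℕ) + 1 < (j : ℕ) →
      ∀ q : (F × (Fin ℓ → ZMod 2)) × ZMod k,
        extCoverMap M Cc ω i (extCoverMap M Cc ω j q) =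
          extCoverMap M Cc ω j (extCoverMap M Cc ω i q) ∧
        extCoverMap M Cc ω i q ≠ extCoverMap M Cc ω j q := by
  rintro i j hij ⟨⟨u, x⟩, a⟩
  have hi : (i : ℕ) < n := by have := j.isLt; omega
  by_cases hj : (j : ℕ) < n
  · have h := hstring ⟨i, hi⟩ ⟨j, hj⟩ hij (u, 0)
    have hne := M.stringNe ⟨i, hi⟩ ⟨j, hj⟩ hij u
    simp only [coverMap, Prod.mk.injEq, sub_zero] at h
    obtain ⟨⟨h1, h2⟩, -⟩ := h
    simp only [extCoverMap, extMap, extWeight, hi, hj, dif_pos, Prod.mk.injEq, ne_eq]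
    refine ⟨⟨⟨h1, trivial⟩, ?_⟩, fun h => hne h.1.1⟩
    have h3 := congrArg (fun z => sgn x • z) h2
    simp only [smul_sub] at h3
    linear_combination h3
  · have hc := hC ⟨i, hi⟩ (by have := j.isLt; simp only; omega) u
    simp only [extCoverMap, extMap, extWeight, hi, hj, dif_pos, dif_neg, not_false_eq_true,
      Prod.mk.injEq, ne_eq, hc, sgn_flip, neg_smul]
    refine ⟨⟨trivial, ?_⟩, fun h => M.free _ _ h.1.1⟩
    ring
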